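/- Let (Λ,d) be a finitely aligned k-graph, E ⊆ Λ finite, and {t_λ : λ ∈ Λ} a Cuntz–Krieger Λ-family. Let λ ∈ ΠE be such that T(λ) is not exhaustive, and let ξ ∈ s(λ)Λ satisfy Λ^min(ξ,ν) = ∅ for all ν ∈ T(λ). Then for all σ,τ ∈ ΠE with d(σ) = d(τ) and s(σ) = s(τ): t_{λξ} t_{λξ}* Θ(t,E;σ,τ) = δ_{λ,σ} t_{λξ} t_{τξ}*. -/

import Mathlib

open scoped BigOperators

/-- A `k`-graph: a countable small category (in arrows-only presentation, with objects
identified with the identity morphisms) together with a degree functor into `ℕ^k`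
satisfying the factorisation property.  `comp l m` is the composite path `lm`
(first `m`, then `l` in categorical order; range `rng l`, source `src m`), and is
only meaningful when `src l = rng m`. -/
structure KGraph (k : ℕ) where
  Path : Type
  countable : Countable Path
  src : Path → Path
  rng : Path → Path
  comp : Path → Path → Path
  deg : Path → Fin k → ℕ
  deg_src : ∀ l, deg (src l) = 0
  deg_rng : ∀ l, deg (rng l) = 0
  src_eq_of_deg_zero : ∀ v, deg v = 0 → src v = v
  rng_eq_of_deg_zero : ∀ v, deg v = 0 → rng v = v
  comp_src_self : ∀ l, comp l (src l) = l
  rng_comp_self : ∀ l, comp (rng l) l = l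
  src_comp : ∀ l m, src l = rng m → src (comp l m) = src m
  rng_comp : ∀ l m, src l = rng m → rng (comp l m) = rng l
  deg_comp : ∀ l m, src l = rng m → deg (comp l m) = deg l + deg m
  comp_assoc : ∀ l m n, src l = rng m → src m = rng n →
    comp (comp l m) n = comp l (comp m n)
  factorisation : ∀ (l : Path) (m n : Fin k → ℕ), deg l = m + n →
    ∃! p : Path × Path, deg p.1 = m ∧ deg p.2 = n ∧ src p.1 = rng p.2 ∧
      comp p.1 p.2 = l

namespace KGraph

variable {k : ℕ} (Λ : KGraph k)

/-- The vertices of a `k`-graph are the paths of degree `0`. -/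
def IsVertex (v : Λ.Path) : Prop := Λ.deg v = 0

/-- An edge is a path of degree `e_i` for some `i`. -/
def IsEdge (e : Λ.Path) : Prop := ∃ i : Fin k, Λ.deg e = Pi.single i 1

/-- `vΛ`, the set of paths with range `v`. -/
def withRange (v : Λ.Path) : Set Λ.Path := {l | Λ.rng l = v}

/-- `Λ^min(l,m)`, the set of pairs giving minimal common extensions of `l` and `m`. -/
def minExt (l m : Λ.Path) : Set (Λ.Path × Λ.Path) :=
  {p | Λ.src l = Λ.rng p.1 ∧ Λ.src m = Λ.rng p.2 ∧
    Λ.comp l p.1 = Λ.comp m p.2 ∧ Λ.deg (Λ.comp l p.1) = Λ.deg l ⊔ Λ.deg m}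

/-- A `k`-graph is finitely aligned if all the sets `Λ^min(l,m)` are finite. -/
def FinitelyAligned : Prop := ∀ l m, (Λ.minExt l m).Finite

/-- A subset `E ⊆ vΛ` is exhaustive if every path in `vΛ` has a common extension
with some member of `E`. -/
def Exhaustive (v : Λ.Path) (E : Set Λ.Path) : Prop :=
  ∀ m ∈ Λ.withRange v, ∃ l ∈ E, (Λ.minExt l m).Nonempty

/-- `Λ^{≤ n}`. -/
def degLe (n : Fin k → ℕ) : Set Λ.Path :=
  {l | Λ.deg l ≤ n ∧ ∀ i : Fin k, Λ.deg l i < n i →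
    ¬∃ e, Λ.rng e = Λ.src l ∧ Λ.deg e = Pi.single i 1}

end KGraph

open Classical in
/-- The sum of `f` over a set `S`, defined to be `0` if `S` is infinite. -/
noncomputable def setSum {ι A : Type*} [AddCommMonoid A] (S : Set ι) (f : ι → A) : A :=
  if h : S.Finite then ∑ i ∈ h.toFinset, f i else 0

open Classical in
/-- The product of `f` over a set `S` taken in an arbitrary (but fixed) order,
defined to be `1` if `S` is infinite.  All products appearing below have commuting
factors, for which this is the usual product over a finite set. -/
noncomputable def setProd {ι A : Type*} [Monoid A] (S : Set ι) (f : ι → A) : A :=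
  if h : S.Finite then (h.toFinset.toList.map f).prod else 1

namespace KGraph

variable {k : ℕ} (Λ : KGraph k) {A : Type*} [Ring A] [StarRing A]

/-- Relations (CK1)–(CK3) for a family of partial isometries indexed by a `k`-graph. -/
structure IsCK13 (t : Λ.Path → A) : Prop where
  partialIsometry : ∀ l, t l * star (t l) * t l = t l
  vertex_projection : ∀ v, Λ.IsVertex v → star (t v) = t v ∧ t v * t v = t v
  vertex_orthogonal : ∀ v w, Λ.IsVertex v → Λ.IsVertex w → v ≠ w → t v * t w = 0
  comp_mul : ∀ l m, Λ.src l = Λ.rng m → t l * t m = t (Λ.comp l m)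
  ck3 : ∀ l m, star (t l) * t m =
    setSum (Λ.minExt l m) fun p => t p.1 * star (t p.2)

/-- A Cuntz–Krieger `Λ`-family: relations (CK1)–(CK4). -/
structure IsCKFamily (t : Λ.Path → A) extends IsCK13 Λ t : Prop where
  ck4 : ∀ v E, Λ.IsVertex v → E ⊆ Λ.withRange v → E.Finite → Λ.Exhaustive v E →
    setProd E (fun l => t v - t l * star (t l)) = 0

/-- Condition (†) on a subset `F ⊆ Λ`. -/
def DaggerClosed (F : Set Λ.Path) : Prop :=
  ∀ l m σ τ a b, l ∈ F → m ∈ F → σ ∈ F → τ ∈ F →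
    Λ.deg l = Λ.deg m → Λ.deg σ = Λ.deg τ →
    Λ.src l = Λ.src m → Λ.src σ = Λ.src τ →
    (a, b) ∈ Λ.minExt m σ → Λ.comp l a ∈ F ∧ Λ.comp τ b ∈ F

/-- `ΠE`, the smallest subset of `Λ` containing `E` and satisfying (†). -/
def piSet (E : Set Λ.Path) : Set Λ.Path := ⋂₀ {F | E ⊆ F ∧ Λ.DaggerClosed F}

/-- For `P ⊆ Λ` and a path `l`, the set `{ν ∈ s(l)Λ : d(ν) > 0 and lν ∈ P}`;
with `P = ΠE` this is the set `T(l)`. -/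
def extInto (P : Set Λ.Path) (l : Λ.Path) : Set Λ.Path :=
  {ν | Λ.src l = Λ.rng ν ∧ Λ.deg ν ≠ 0 ∧ Λ.comp l ν ∈ P}

/-- The projection `Q(t)^{ΠE}_l`. -/
noncomputable def Qproj (t : Λ.Path → A) (E : Set Λ.Path) (l : Λ.Path) : A :=
  t l * star (t l) *
    setProd (Λ.extInto (Λ.piSet E) l)
      (fun ν => t l * star (t l) - t (Λ.comp l ν) * star (t (Λ.comp l ν)))

/-- The matrix unit `Θ(t,E;l,m) = Q(t)^{ΠE}_l t_l t_m^*`. -/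
noncomputable def Theta (t : Λ.Path → A) (E : Set Λ.Path) (l m : Λ.Path) : A :=
  Λ.Qproj t E l * (t l * star (t m))

end KGraph

/-- A degree-preserving functor `x : Ω_{k,m} → Λ` for some `m ∈ (ℕ ∪ {∞})^k`,
recorded by its degree `m` and its values `map p q` on the morphisms `(p,q)` of
`Ω_{k,m}` (normalised to the junk value `map 0 0` on pairs `(p,q)` that are not
morphisms of `Ω_{k,m}`). -/
structure OmegaMor {k : ℕ} (Λ : KGraph k) where
  m : Fin k → ℕ∞
  map : (Fin k → ℕ) → (Fin k → ℕ) → Λ.Path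
  deg_map : ∀ p q : Fin k → ℕ, p ≤ q → (∀ i, (q i : ℕ∞) ≤ m i) →
    Λ.deg (map p q) = q - p
  rng_map : ∀ p q : Fin k → ℕ, p ≤ q → (∀ i, (q i : ℕ∞) ≤ m i) →
    Λ.rng (map p q) = map p p
  src_map : ∀ p q : Fin k → ℕ, p ≤ q → (∀ i, (q i : ℕ∞) ≤ m i) →
    Λ.src (map p q) = map q q
  comp_map : ∀ p q r : Fin k → ℕ, p ≤ q → q ≤ r → (∀ i, (r i : ℕ∞) ≤ m i) →
    Λ.comp (map p q) (map q r) = map p r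
  map_default : ∀ p q : Fin k → ℕ, ¬(p ≤ q ∧ ∀ i, (q i : ℕ∞) ≤ m i) →
    map p q = map 0 0

/-- `x` is a boundary path: there is `n_x ≤ m` such that whenever `n_x ≤ n ≤ m`
and `n_i = m_i`, the vertex `x(n)` receives no edge of degree `e_i`. -/
def OmegaMor.IsBoundary {k : ℕ} {Λ : KGraph k} (x : OmegaMor Λ) : Prop :=
  ∃ nx : Fin k → ℕ, (∀ i, (nx i : ℕ∞) ≤ x.m i) ∧
    ∀ n : Fin k → ℕ, nx ≤ n → (∀ i, (n i : ℕ∞) ≤ x.m i) →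
      ∀ i : Fin k, (n i : ℕ∞) = x.m i →
        ¬∃ e, Λ.rng e = x.map n n ∧ Λ.deg e = Pi.single i 1


namespace KGraph

section Paths

variable {k : ℕ} (Λ : KGraph k)

theorem src_src (l : Λ.Path) : Λ.src (Λ.src l) = Λ.src l :=
  Λ.src_eq_of_deg_zero _ (Λ.deg_src l)

theorem rng_src (l : Λ.Path) : Λ.rng (Λ.src l) = Λ.src l :=
  Λ.rng_eq_of_deg_zero _ (Λ.deg_src l)

variable {Λ}

theorem comp_inj {l m p q : Λ.Path} (hl : Λ.src l = Λ.rng p) (hm : Λ.src m = Λ.rng q)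
    (hd : Λ.deg l = Λ.deg m) (h : Λ.comp l p = Λ.comp m q) : l = m ∧ p = q := by
  have h₁ := Λ.deg_comp l p hl
  have h₂ := Λ.deg_comp m q hm
  have hpq : Λ.deg q = Λ.deg p := by
    rw [h, h₂, hd] at h₁
    exact add_left_cancel h₁
  have := (Λ.factorisation _ _ _ h₁).unique (y₁ := (l, p)) (y₂ := (m, q))
    ⟨rfl, rfl, hl, rfl⟩ ⟨hd.symm, hpq, hm, h.symm⟩
  exact ⟨congrArg Prod.fst this, congrArg Prod.snd this⟩

theorem comp_of_deg_eq_zero {l p : Λ.Path} (hl : Λ.src l = Λ.rng p) (hp : Λ.deg p = 0) :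
    Λ.comp l p = l := by
  rw [Λ.rng_eq_of_deg_zero p hp] at hl
  rw [← hl, Λ.comp_src_self]

/-- Every common extension factors through a minimal one. -/
theorem exists_minExt {l m p q : Λ.Path} (hl : Λ.src l = Λ.rng p) (hm : Λ.src m = Λ.rng q)
    (h : Λ.comp l p = Λ.comp m q) :
    ∃ a b c, (a, b) ∈ Λ.minExt l m ∧ Λ.src a = Λ.rng c ∧ Λ.src b = Λ.rng c ∧
      p = Λ.comp a c ∧ q = Λ.comp b c := by
  have h₁ := Λ.deg_comp l p hl
  have h₂ := Λ.deg_comp m q hm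
  have hlp : Λ.deg l ⊔ Λ.deg m ≤ Λ.deg (Λ.comp l p) :=
    sup_le (by rw [h₁]; exact le_self_add) (by rw [h, h₂]; exact le_self_add)
  obtain ⟨n, hn⟩ := exists_add_of_le hlp
  obtain ⟨⟨y, c⟩, ⟨hy, -, hyc, hcomp⟩, -⟩ := Λ.factorisation _ _ _ hn
  dsimp only at hy hyc hcomp
  obtain ⟨n₁, hn₁⟩ := exists_add_of_le (hy.symm ▸ le_sup_left : Λ.deg l ≤ Λ.deg y)
  obtain ⟨n₂, hn₂⟩ := exists_add_of_le (hy.symm ▸ le_sup_right : Λ.deg m ≤ Λ.deg y)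
  obtain ⟨⟨l', a⟩, ⟨hl', -, hla, hly⟩, -⟩ := Λ.factorisation _ _ _ hn₁
  obtain ⟨⟨m', b⟩, ⟨hm', -, hmb, hmy⟩, -⟩ := Λ.factorisation _ _ _ hn₂
  dsimp only at hl' hla hly hm' hmb hmy
  have hac : Λ.src a = Λ.rng c := by rw [← hyc, ← hly, Λ.src_comp _ _ hla]
  have hbc : Λ.src b = Λ.rng c := by rw [← hyc, ← hmy, Λ.src_comp _ _ hmb]
  have e₁ : Λ.comp l p = Λ.comp l' (Λ.comp a c) := by
    rw [← Λ.comp_assoc _ _ _ hla hac, hly, hcomp]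
  have e₂ : Λ.comp m q = Λ.comp m' (Λ.comp b c) := by
    rw [← Λ.comp_assoc _ _ _ hmb hbc, hmy, hcomp, h]
  obtain ⟨rfl, hp⟩ := comp_inj hl (by rw [hla, Λ.rng_comp _ _ hac]) hl'.symm e₁
  obtain ⟨rfl, hq⟩ := comp_inj hm (by rw [hmb, Λ.rng_comp _ _ hbc]) hm'.symm e₂
  exact ⟨a, b, c, ⟨hla, hmb, hly.trans hmy.symm, hly ▸ hy⟩, hac, hbc, hp, hq⟩

theorem minExt_self (l : Λ.Path) : Λ.minExt l l = {(Λ.src l, Λ.src l)} := by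
  ext ⟨a, b⟩
  simp only [minExt, Set.mem_ofPred_eq, Set.mem_singleton_iff, Prod.mk.injEq, sup_idem]
  constructor
  · rintro ⟨ha, hb, hab, hd⟩
    obtain ⟨-, rfl⟩ := comp_inj ha hb rfl hab
    rw [Λ.deg_comp _ _ ha] at hd
    have h0 : Λ.deg a = 0 := by simpa using hd
    rw [ha, Λ.rng_eq_of_deg_zero a h0]
    exact ⟨rfl, rfl⟩
  · rintro ⟨rfl, rfl⟩
    simp [Λ.rng_src, Λ.comp_src_self]

/-- Paths of degree `n` arising from (†) applied to members of `P` of degree less than `n`. -/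
def lowerExt (P : Set Λ.Path) (n : Fin k → ℕ) : Set Λ.Path :=
  {x | ∃ m σ τ a b, m ∈ P ∧ σ ∈ P ∧ τ ∈ P ∧ Λ.deg m < n ∧ Λ.deg σ < n ∧ Λ.deg τ < n ∧
    (a, b) ∈ Λ.minExt m σ ∧ x = Λ.comp τ b}

/-- Paths obtained from members of `B` by exchanging an initial segment in `P` of degree less
than `n` for another one of the same degree. -/
def exchange (P B : Set Λ.Path) (n : Fin k → ℕ) : Set Λ.Path :=
  {x | ∃ σ τ b, σ ∈ P ∧ τ ∈ P ∧ Λ.deg σ = Λ.deg τ ∧ Λ.deg σ < n ∧ Λ.src σ = Λ.rng b ∧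
    Λ.src τ = Λ.rng b ∧ Λ.comp σ b ∈ B ∧ x = Λ.comp τ b}

theorem minExt_symm {l m a b : Λ.Path} (h : (a, b) ∈ Λ.minExt l m) : (b, a) ∈ Λ.minExt m l := by
  obtain ⟨h₁, h₂, h₃, h₄⟩ := h
  exact ⟨h₂, h₁, h₃.symm, by rw [← h₃, sup_comm]; exact h₄⟩

theorem finite_lowerExt (hΛ : Λ.FinitelyAligned) {P : Set Λ.Path} {n : Fin k → ℕ}
    (hP : {x ∈ P | Λ.deg x < n}.Finite) : (lowerExt P n).Finite := by
  refine (hP.biUnion fun m _ => hP.biUnion fun σ _ => hP.biUnion fun τ _ =>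
    (hΛ m σ).image fun p => Λ.comp τ p.2).subset ?_
  rintro x ⟨m, σ, τ, a, b, hm, hσ, hτ, hmn, hσn, hτn, hab, rfl⟩
  simp only [Set.mem_iUnion]
  exact ⟨m, ⟨hm, hmn⟩, σ, ⟨hσ, hσn⟩, τ, ⟨hτ, hτn⟩, (a, b), hab, rfl⟩

theorem finite_exchange {P B : Set Λ.Path} {n : Fin k → ℕ}
    (hP : {x ∈ P | Λ.deg x < n}.Finite) (hB : B.Finite) : (exchange P B n).Finite := by
  refine (hP.biUnion fun σ _ => hP.biUnion fun τ _ => hB.biUnion fun y _ =>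
    (Set.Subsingleton.finite (s := {b | Λ.src σ = Λ.rng b ∧ Λ.comp σ b = y}) ?_).image
      fun b => Λ.comp τ b).subset ?_
  · rintro b ⟨hb, hby⟩ c ⟨hc, hcy⟩
    exact (comp_inj hb hc rfl (hby.trans hcy.symm)).2
  · rintro x ⟨σ, τ, b, hσ, hτ, hd, hσn, hσb, hτb, hB', rfl⟩
    simp only [Set.mem_iUnion]
    exact ⟨σ, ⟨hσ, hσn⟩, τ, ⟨hτ, hd ▸ hσn⟩, _, hB', b, ⟨hσb, rfl⟩, rfl⟩

variable (Λ) in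
theorem subset_piSet (E : Set Λ.Path) : E ⊆ Λ.piSet E :=
  Set.subset_sInter fun _ hF => hF.1

variable (Λ) in
theorem daggerClosed_piSet (E : Set Λ.Path) : Λ.DaggerClosed (Λ.piSet E) := by
  intro l m σ τ a b hl hm hσ hτ h₁ h₂ h₃ h₄ hab
  have key : ∀ F, E ⊆ F ∧ Λ.DaggerClosed F → Λ.comp l a ∈ F ∧ Λ.comp τ b ∈ F := fun F hF =>
    hF.2 l m σ τ a b (hl F hF) (hm F hF) (hσ F hF) (hτ F hF) h₁ h₂ h₃ h₄ hab
  exact ⟨fun F hF => (key F hF).1, fun F hF => (key F hF).2⟩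

theorem piSet_subset {E F : Set Λ.Path} (hE : E ⊆ F) (hF : Λ.DaggerClosed F) :
    Λ.piSet E ⊆ F :=
  Set.sInter_subset_of_mem ⟨hE, hF⟩

/-- Condition (†) may be verified for one of the two paths only. -/
theorem DaggerClosed.of_right {F : Set Λ.Path}
    (h : ∀ m σ τ a b, m ∈ F → σ ∈ F → τ ∈ F → Λ.deg σ = Λ.deg τ → Λ.src σ = Λ.src τ →
      (a, b) ∈ Λ.minExt m σ → Λ.comp τ b ∈ F) : Λ.DaggerClosed F :=
  fun l m σ τ a b hl hm hσ hτ h₁ h₂ h₃ h₄ hab =>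
    ⟨h σ m l b a hσ hm hl h₁.symm h₃.symm (minExt_symm hab), h m σ τ a b hm hσ hτ h₂ h₄ hab⟩

theorem piSet_subset_deg_le (E : Set Λ.Path) {N : Fin k → ℕ} (hN : ∀ x ∈ E, Λ.deg x ≤ N) :
    ∀ x ∈ Λ.piSet E, Λ.deg x ≤ N := by
  refine piSet_subset (F := {x | Λ.deg x ≤ N}) hN (DaggerClosed.of_right ?_)
  rintro m σ τ a b hm hσ hτ hd hs ⟨h₁, h₂, h₃, h₄⟩
  change Λ.deg (Λ.comp τ b) ≤ N
  rw [Λ.deg_comp _ _ (hs ▸ h₂), ← hd, ← Λ.deg_comp _ _ h₂, ← h₃, h₄]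
  exact sup_le hm hσ

theorem piSet_subset_exchange (E : Set Λ.Path) :
    ∀ x ∈ Λ.piSet E, x ∈ E ∪ lowerExt (Λ.piSet E) (Λ.deg x) ∨
      x ∈ exchange (Λ.piSet E) (E ∪ lowerExt (Λ.piSet E) (Λ.deg x)) (Λ.deg x) := by
  set P := Λ.piSet E
  have hPc : Λ.DaggerClosed P := Λ.daggerClosed_piSet E
  suffices h : P ⊆ {x ∈ P | x ∈ E ∪ lowerExt P (Λ.deg x) ∨
      x ∈ exchange P (E ∪ lowerExt P (Λ.deg x)) (Λ.deg x)} from fun x hx => (h hx).2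
  refine piSet_subset (fun x hx => ⟨Λ.subset_piSet E hx, .inl (.inl hx)⟩)
    (DaggerClosed.of_right ?_)
  rintro m σ τ a b ⟨hmP, hm⟩ ⟨hσP, -⟩ ⟨hτP, hτ⟩ hd hs hab
  obtain ⟨ha, hb, hab', hdab⟩ := id hab
  have hb' : Λ.src τ = Λ.rng b := hs ▸ hb
  have hdeg : Λ.deg (Λ.comp τ b) = Λ.deg m ⊔ Λ.deg σ := by
    rw [Λ.deg_comp _ _ hb', ← hd, ← Λ.deg_comp _ _ hb, ← hab', hdab]
  have hmem : Λ.comp τ b ∈ P := (hPc m m σ τ a b hmP hmP hσP hτP rfl hd rfl hs hab).2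
  refine ⟨hmem, ?_⟩
  by_cases hb0 : Λ.deg b = 0
  · rwa [comp_of_deg_eq_zero hb' hb0]
  have hσn : Λ.deg σ < Λ.deg (Λ.comp τ b) := by
    rw [Λ.deg_comp _ _ hb', ← hd]
    exact lt_add_of_pos_right _ (pos_iff_ne_zero.2 hb0)
  by_cases ha0 : Λ.deg a = 0
  · rw [comp_of_deg_eq_zero ha ha0] at hab' hdab
    have hmn : Λ.deg (Λ.comp τ b) = Λ.deg m := by rw [hdeg, ← hdab]
    rw [hmn] at hσn ⊢
    rcases hm with hm | ⟨σ', τ', c, hσ', hτ', hd', hσn', hσc, hτc, hB, rfl⟩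
    · exact .inr ⟨σ, τ, b, hσP, hτP, hd, hσn, hb, hb', hab' ▸ hm, rfl⟩
    obtain ⟨u, v, w, huv, huw, hvw, rfl, rfl⟩ := exists_minExt hτc hb hab'
    obtain ⟨hu, hv, huv', -⟩ := id huv
    rw [Λ.rng_comp _ _ huw] at hσc hτc
    rw [Λ.rng_comp _ _ hvw] at hb hb'
    have h₁ : Λ.comp σ' u ∈ P :=
      (hPc σ' τ' σ σ u v hσ' hτ' hσP hσP hd' rfl (hσc.trans hτc.symm) rfl huv).1
    have h₂ : Λ.comp τ v ∈ P :=
      (hPc τ' τ' σ τ u v hτ' hτ' hσP hτP rfl hd rfl hs huv).2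
    by_cases hw : Λ.deg w = 0
    · rw [comp_of_deg_eq_zero hvw hw]
      exact .inl (.inr ⟨τ', σ, τ, u, v, hτ', hσP, hτP, hd' ▸ hσn', hσn, hd ▸ hσn, huv, rfl⟩)
    have e : Λ.deg (Λ.comp σ' u) = Λ.deg (Λ.comp τ v) := by
      rw [Λ.deg_comp _ _ hσc, Λ.deg_comp _ _ hb', hd', ← hd, ← Λ.deg_comp _ _ hu,
        ← Λ.deg_comp _ _ hv, huv']
    have s₁ : Λ.src (Λ.comp σ' u) = Λ.rng w := by rw [Λ.src_comp _ _ hσc, huw]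
    have s₂ : Λ.src (Λ.comp τ v) = Λ.rng w := by rw [Λ.src_comp _ _ hb', hvw]
    refine .inr ⟨Λ.comp σ' u, Λ.comp τ v, w, h₁, h₂, e, ?_, s₁, s₂, ?_, ?_⟩
    · rw [← hmn, ← Λ.comp_assoc _ _ _ hb' hvw, Λ.deg_comp _ _ s₂, e]
      exact lt_add_of_pos_right _ (pos_iff_ne_zero.2 hw)
    · rwa [Λ.comp_assoc _ _ _ hσc huw]
    · rw [Λ.comp_assoc _ _ _ hb' hvw]
  · have hmn : Λ.deg m < Λ.deg (Λ.comp τ b) := by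
      rw [hdeg, ← hdab, Λ.deg_comp _ _ ha]
      exact lt_add_of_pos_right _ (pos_iff_ne_zero.2 ha0)
    exact .inl (.inr ⟨m, σ, τ, a, b, hmP, hσP, hτP, hmn, hσn, hd ▸ hσn, hab, rfl⟩)

theorem finite_piSet (hΛ : Λ.FinitelyAligned) {E : Set Λ.Path} (hE : E.Finite) :
    (Λ.piSet E).Finite := by
  have hn : ∀ n : Fin k → ℕ, {x ∈ Λ.piSet E | Λ.deg x = n}.Finite := by
    intro n
    induction n using WellFoundedLT.induction with
    | ind n ih =>
    have hlt : {x ∈ Λ.piSet E | Λ.deg x < n}.Finite := by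
      refine ((Set.finite_Iio n).biUnion ih).subset fun x hx => ?_
      simp only [Set.mem_iUnion]
      exact ⟨Λ.deg x, hx.2, hx.1, rfl⟩
    have hB := hE.union (finite_lowerExt hΛ hlt)
    refine (hB.union (finite_exchange hlt hB)).subset ?_
    rintro x ⟨hx, rfl⟩
    exact piSet_subset_exchange E x hx
  refine ((Set.finite_Iic (hE.toFinset.sup Λ.deg)).biUnion fun n _ => hn n).subset fun x hx => ?_
  simp only [Set.mem_iUnion]
  exact ⟨Λ.deg x, piSet_subset_deg_le E
    (fun y hy => Finset.le_sup (f := Λ.deg) (hE.mem_toFinset.2 hy)) x hx, hx, rfl⟩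

theorem finite_extInto {P : Set Λ.Path} (hP : P.Finite) (l : Λ.Path) :
    (Λ.extInto P l).Finite := by
  refine Set.Finite.of_finite_image (f := Λ.comp l) (hP.subset ?_) ?_
  · rintro _ ⟨ν, hν, rfl⟩
    exact hν.2.2
  · intro ν hν ν' hν' h
    exact (comp_inj hν.1 hν'.1 rfl h).2

/-- A common extension of `lξ` and `σ` forces `σ` to be an initial segment of `l` if `ξ` has no
common extension with any nontrivial extension of `l` into a (†)-closed set. -/
theorem exists_comp_eq {P : Set Λ.Path} (hP : Λ.DaggerClosed P) {l ξ σ : Λ.Path}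
    (hl : l ∈ P) (hσ : σ ∈ P) (hξr : Λ.rng ξ = Λ.src l)
    (hξ : ∀ ν ∈ Λ.extInto P l, Λ.minExt ξ ν = ∅)
    (h : (Λ.minExt (Λ.comp l ξ) σ).Nonempty) :
    ∃ b, Λ.src σ = Λ.rng b ∧ Λ.comp σ b = l := by
  obtain ⟨⟨p, q⟩, hp, hq, hpq, -⟩ := h
  dsimp only at hp hq hpq
  rw [Λ.src_comp _ _ hξr.symm] at hp
  rw [Λ.comp_assoc _ _ _ hξr.symm hp] at hpq
  obtain ⟨a, b, c, hab, hac, -, hξp, -⟩ :=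
    exists_minExt (by rw [Λ.rng_comp _ _ hp, hξr]) hq hpq
  have ha0 : Λ.deg a = 0 := by
    by_contra ha0
    have := hξ a ⟨hab.1, ha0, (hP l l σ σ a b hl hl hσ hσ rfl rfl rfl rfl hab).1⟩
    obtain ⟨u, v, -, huv, -⟩ := exists_minExt hp hac hξp
    exact Set.notMem_empty _ (this ▸ huv)
  obtain ⟨h₁, h₂, h₃, -⟩ := hab
  exact ⟨b, h₂, by rw [← h₃, comp_of_deg_eq_zero h₁ ha0]⟩

theorem minExt_comp_comp {l ξ ν : Λ.Path} (hξ : Λ.src l = Λ.rng ξ) (hν : Λ.src l = Λ.rng ν)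
    (h : Λ.minExt ξ ν = ∅) : Λ.minExt (Λ.comp l ξ) (Λ.comp l ν) = ∅ := by
  rw [Set.eq_empty_iff_forall_notMem] at h ⊢
  rintro ⟨a, b⟩ ⟨ha, hb, hab, -⟩
  dsimp only at ha hb hab
  rw [Λ.src_comp _ _ hξ] at ha
  rw [Λ.src_comp _ _ hν] at hb
  rw [Λ.comp_assoc _ _ _ hξ ha, Λ.comp_assoc _ _ _ hν hb] at hab
  obtain ⟨-, hab⟩ := comp_inj (by rwa [Λ.rng_comp _ _ ha]) (by rwa [Λ.rng_comp _ _ hb]) rfl hab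
  obtain ⟨u, v, -, huv, -⟩ := exists_minExt ha hb hab
  exact h _ huv

end Paths

section Products

variable {ι A : Type*}

theorem mul_setProd_eq_self [Monoid A] {S : Set ι} {f : ι → A} {x : A}
    (h : ∀ i ∈ S, x * f i = x) : x * setProd S f = x := by
  unfold setProd
  split_ifs with hS
  · suffices ∀ L : List ι, (∀ i ∈ L, i ∈ S) → x * (L.map f).prod = x from
      this _ fun i hi => by simpa using hi
    intro L hL
    induction L with
    | nil => simp
    | cons i L ih =>
      rw [List.map_cons, List.prod_cons, ← mul_assoc, h i (hL i List.mem_cons_self)]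
      exact ih fun j hj => hL j (List.mem_cons_of_mem _ hj)
  · exact mul_one x

theorem mul_setProd_eq_zero [MonoidWithZero A] {S : Set ι} (hS : S.Finite) {f : ι → A} {x : A}
    (hc : ∀ i ∈ S, Commute x (f i)) {j : ι} (hj : j ∈ S) (h : x * f j = 0) :
    x * setProd S f = 0 := by
  rw [setProd, dif_pos hS]
  suffices ∀ L : List ι, (∀ i ∈ L, i ∈ S) → j ∈ L → x * (L.map f).prod = 0 from
    this _ (fun i hi => by simpa using hi) (by simpa using hj)
  intro L hL hjL
  induction L with
  | nil => simp at hjL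
  | cons i L ih =>
    rw [List.map_cons, List.prod_cons, ← mul_assoc]
    rcases List.mem_cons.1 hjL with rfl | hjL
    · rw [h, zero_mul]
    · rw [(hc i (hL i List.mem_cons_self)).eq, mul_assoc,
        ih (fun j hj => hL j (List.mem_cons_of_mem _ hj)) hjL, mul_zero]

end Products

namespace IsCK13

variable {k : ℕ} {Λ : KGraph k} {A : Type*} [Ring A] [StarRing A] {t : Λ.Path → A}

theorem star_mul_self (ht : Λ.IsCK13 t) (l : Λ.Path) : star (t l) * t l = t (Λ.src l) := by
  obtain ⟨h₁, h₂⟩ := ht.vertex_projection _ (Λ.deg_src l)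
  rw [ht.ck3, minExt_self, setSum, dif_pos (Set.finite_singleton _)]
  simp [h₁, h₂]

theorem star_mul_eq_zero (ht : Λ.IsCK13 t) {l m : Λ.Path} (h : Λ.minExt l m = ∅) :
    star (t l) * t m = 0 := by
  rw [ht.ck3, h, setSum, dif_pos Set.finite_empty]
  simp

theorem range_mul_range (hΛ : Λ.FinitelyAligned) (ht : Λ.IsCK13 t) (l m : Λ.Path) :
    t l * star (t l) * (t m * star (t m)) = ∑ p ∈ (hΛ l m).toFinset,
      t (Λ.comp l p.1) * star (t (Λ.comp l p.1)) := by
  rw [mul_assoc, ← mul_assoc (star (t l)), ht.ck3, setSum, dif_pos (hΛ l m), Finset.sum_mul,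
    Finset.mul_sum]
  refine Finset.sum_congr rfl fun p hp => ?_
  obtain ⟨h₁, h₂, h₃, -⟩ := (hΛ l m).mem_toFinset.1 hp
  nth_rewrite 2 [h₃]
  rw [← ht.comp_mul _ _ h₁, ← ht.comp_mul _ _ h₂, star_mul]
  simp only [mul_assoc]

theorem commute_range (hΛ : Λ.FinitelyAligned) (ht : Λ.IsCK13 t) (l m : Λ.Path) :
    Commute (t l * star (t l)) (t m * star (t m)) := by
  have h : star (t l * star (t l) * (t m * star (t m))) =
      t l * star (t l) * (t m * star (t m)) := by
    rw [ht.range_mul_range hΛ, star_sum]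
    exact Finset.sum_congr rfl fun p _ => by rw [star_mul, star_star]
  rw [Commute, SemiconjBy, ← h]
  simp only [star_mul, star_star]

/-- The range projection of an extension of `l` lies below that of `l`. -/
theorem range_comp_mul_range (ht : Λ.IsCK13 t) {l m : Λ.Path} (h : Λ.src l = Λ.rng m) :
    t (Λ.comp l m) * star (t (Λ.comp l m)) * (t l * star (t l)) =
      t (Λ.comp l m) * star (t (Λ.comp l m)) := by
  have hl : star (t l) * t l * star (t l) = star (t l) := by
    simpa [mul_assoc] using congrArg star (ht.partialIsometry l)
  rw [← ht.comp_mul _ _ h, star_mul]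
  simp only [mul_assoc] at hl ⊢
  rw [hl]

theorem range_comp_mul (ht : Λ.IsCK13 t) {l m τ : Λ.Path} (h : Λ.src l = Λ.rng m)
    (hτ : Λ.src l = Λ.src τ) :
    t (Λ.comp l m) * star (t (Λ.comp l m)) * (t l * star (t τ)) =
      t (Λ.comp l m) * star (t (Λ.comp τ m)) := by
  have hm : star (t m) * t (Λ.src l) = star (t m) := by
    have := congrArg star (ht.comp_mul (Λ.src l) m (by rw [Λ.src_src, h]))
    rwa [star_mul, (ht.vertex_projection _ (Λ.deg_src l)).1, h, Λ.rng_comp_self, ← h] at this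
  calc t (Λ.comp l m) * star (t (Λ.comp l m)) * (t l * star (t τ))
      = t (Λ.comp l m) * (star (t m) * (star (t l) * t l)) * star (t τ) := by
        nth_rewrite 2 [← ht.comp_mul _ _ h]
        rw [star_mul]
        simp only [mul_assoc]
    _ = t (Λ.comp l m) * star (t (Λ.comp τ m)) := by
        rw [ht.star_mul_self, hm, ← ht.comp_mul τ m (hτ ▸ h), star_mul, mul_assoc]

variable {E : Set Λ.Path} {l ξ : Λ.Path}

theorem range_comp_mul_Qproj_self (ht : Λ.IsCK13 t) (hξr : Λ.src l = Λ.rng ξ)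
    (hξ : ∀ ν ∈ Λ.extInto (Λ.piSet E) l, Λ.minExt ξ ν = ∅) :
    t (Λ.comp l ξ) * star (t (Λ.comp l ξ)) * Λ.Qproj t E l =
      t (Λ.comp l ξ) * star (t (Λ.comp l ξ)) := by
  rw [Qproj, ← mul_assoc, ht.range_comp_mul_range hξr]
  refine mul_setProd_eq_self fun ν hν => ?_
  rw [mul_sub, ht.range_comp_mul_range hξr, mul_assoc, ← mul_assoc (star _),
    ht.star_mul_eq_zero (minExt_comp_comp hξr hν.1 (hξ ν hν)), zero_mul, mul_zero, sub_zero]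

theorem range_comp_mul_Qproj_of_ne (hΛ : Λ.FinitelyAligned) (hE : E.Finite) (ht : Λ.IsCK13 t)
    (hl : l ∈ Λ.piSet E) (hξr : Λ.src l = Λ.rng ξ)
    (hξ : ∀ ν ∈ Λ.extInto (Λ.piSet E) l, Λ.minExt ξ ν = ∅)
    {σ : Λ.Path} (hσ : σ ∈ Λ.piSet E) (hne : l ≠ σ) :
    t (Λ.comp l ξ) * star (t (Λ.comp l ξ)) * Λ.Qproj t E σ = 0 := by
  rw [Qproj]
  rcases Set.eq_empty_or_nonempty (Λ.minExt (Λ.comp l ξ) σ) with h | h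
  · rw [← mul_assoc, mul_assoc (t _), ← mul_assoc (star _) (t σ), ht.star_mul_eq_zero h]
    simp only [zero_mul, mul_zero]
  obtain ⟨b, hb, rfl⟩ := exists_comp_eq (Λ.daggerClosed_piSet E) hl hσ hξr.symm hξ h
  have hbσ : t (Λ.comp (Λ.comp σ b) ξ) * star (t (Λ.comp (Λ.comp σ b) ξ)) * (t σ * star (t σ)) =
      t (Λ.comp (Λ.comp σ b) ξ) * star (t (Λ.comp (Λ.comp σ b) ξ)) := by
    rw [Λ.src_comp _ _ hb] at hξr
    rw [Λ.comp_assoc _ _ _ hb hξr]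
    exact ht.range_comp_mul_range (by rw [hb, Λ.rng_comp _ _ hξr])
  rw [← mul_assoc, hbσ]
  refine mul_setProd_eq_zero (finite_extInto (finite_piSet hΛ hE) σ)
    (fun ν _ => (ht.commute_range hΛ _ _).sub_right (ht.commute_range hΛ _ _))
    (j := b) ⟨hb, fun hb0 => hne (comp_of_deg_eq_zero hb hb0), hl⟩ ?_
  rw [mul_sub, hbσ, ht.range_comp_mul_range hξr, sub_self]

end IsCK13

end KGraph

open Classical in
/-- with `l, ξ` as in Statement 12, for `σ,τ ∈ ΠE` with `d(σ)=d(τ)`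
and `s(σ)=s(τ)`, `t_{lξ} t_{lξ}^* Θ(t,E;σ,τ) = δ_{l,σ} t_{lξ} t_{τξ}^*`. -/
theorem stmt13 {k : ℕ} (Λ : KGraph k) (hΛ : Λ.FinitelyAligned)
    (E : Set Λ.Path) (hE : E.Finite) {A : Type*} [CStarAlgebra A]
    (t : Λ.Path → A) (ht : Λ.IsCKFamily t)
    (l : Λ.Path) (hl : l ∈ Λ.piSet E)
    (hT : ¬ Λ.Exhaustive (Λ.src l) (Λ.extInto (Λ.piSet E) l))
    (ξ : Λ.Path) (hξr : Λ.rng ξ = Λ.src l)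
    (hξ : ∀ ν ∈ Λ.extInto (Λ.piSet E) l, Λ.minExt ξ ν = ∅)
    (σ τ : Λ.Path) (hσ : σ ∈ Λ.piSet E) (hτ : τ ∈ Λ.piSet E)
    (hdeg : Λ.deg σ = Λ.deg τ) (hsrc : Λ.src σ = Λ.src τ) :
    t (Λ.comp l ξ) * star (t (Λ.comp l ξ)) * Λ.Theta t E σ τ =
      if l = σ then t (Λ.comp l ξ) * star (t (Λ.comp τ ξ)) else 0 := by
  rw [KGraph.Theta, ← mul_assoc]
  split_ifs with h
  · subst h
    rw [ht.toIsCK13.range_comp_mul_Qproj_self hξr.symm hξ, ht.toIsCK13.range_comp_mul hξr.symm hsrc]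
  · rw [ht.toIsCK13.range_comp_mul_Qproj_of_ne hΛ hE hl hξr.symm hξ hσ h, zero_mul]
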